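/- arXiv:2005.09494 — 8 statements merged into one kernel-verified Lean document; each statement's English description precedes it below -/
import Mathlib

section
/- Let α be a real number with α > 0 and α ≠ 1, let β be a nonzero complex number, let a₁, a₂, a₃ be real numbers and b₁, b₂, b₃ complex numbers. Define the bijections g₀, g₁, g₂, g₃ of ℂ × ℂ by g₀(w,z) = (α·w, β·z) and gᵢ(w,z) = (w + aᵢ, z + bᵢ) for i = 1,2,3. If an element g of the subgroup of Equiv.Perm (ℂ × ℂ) generated by {g₀, g₁, g₂, g₃} fixes some point (w,z) with Im w > 0, then g is the identity permutation. (This is the freeness of the action of the group G_M^± defining an Inoue surface of type S_M on ℍ × ℂ.) -/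
/-- The bijections `(w, z) ↦ (αⁿ w + a, βⁿ z + b)` of `ℂ × ℂ` with `n` an integer, `a` real and
`b` complex. -/
def inoueAffineSubgroup (α : ℝ) (hα : α ≠ 0) (β : ℂ) (hβ : β ≠ 0) :
    Subgroup (Equiv.Perm (ℂ × ℂ)) where
  carrier := {g | ∃ (n : ℤ) (a : ℝ) (b : ℂ),
    ∀ w z : ℂ, g (w, z) = ((α : ℂ) ^ n * w + a, β ^ n * z + b)}
  one_mem' := ⟨0, 0, 0, by simp⟩
  mul_mem' := by
    rintro g h ⟨n, a, b, hg⟩ ⟨m, c, d, hh⟩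
    have hα' : (α : ℂ) ≠ 0 := by exact_mod_cast hα
    refine ⟨n + m, α ^ n * c + a, β ^ n * d + b, fun w z => ?_⟩
    rw [Equiv.Perm.mul_apply, hh, hg, zpow_add₀ hα', zpow_add₀ hβ]
    push_cast
    ext1 <;> ring
  inv_mem' := by
    rintro g ⟨n, a, b, hg⟩
    have hα' : (α : ℂ) ^ n ≠ 0 := zpow_ne_zero n (by exact_mod_cast hα)
    have hβ' : β ^ n ≠ 0 := zpow_ne_zero n hβ
    refine ⟨-n, -((α ^ n)⁻¹ * a), -((β ^ n)⁻¹ * b), fun w z => ?_⟩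
    rw [Equiv.Perm.inv_eq_iff_eq, hg, zpow_neg, zpow_neg]
    push_cast
    ext1 <;> field_simp <;> ring

theorem eq_one_of_mem_inoueAffineSubgroup {α : ℝ} (hα : 0 < α) (hα1 : α ≠ 1) {β : ℂ}
    (hβ : β ≠ 0) {g : Equiv.Perm (ℂ × ℂ)} (hg : g ∈ inoueAffineSubgroup α hα.ne' β hβ)
    {w z : ℂ} (hw : w.im ≠ 0) (hfix : g (w, z) = (w, z)) : g = 1 := by
  obtain ⟨n, a, b, h⟩ := hg
  rw [h, Prod.mk.injEq] at hfix
  obtain ⟨h₁, h₂⟩ := hfix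
  have him := congrArg Complex.im h₁
  rw [← Complex.ofReal_zpow, Complex.add_im, Complex.im_ofReal_mul, Complex.ofReal_im,
    add_zero, mul_eq_right₀ hw] at him
  obtain rfl : n = 0 := (zpow_eq_one_iff_right₀ hα.le hα1).mp him
  rw [zpow_zero, one_mul, add_eq_left] at h₁ h₂
  ext1 ⟨u, v⟩
  simp [h, h₁, h₂]


/-- Freeness of the action of the group `G_M^±` defining an Inoue surface of type `S_M`
on `ℍ × ℂ`. -/
theorem stmt_0 (α : ℝ) (hα : 0 < α) (hα1 : α ≠ 1) (β : ℂ) (hβ : β ≠ 0)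
    (a₁ a₂ a₃ : ℝ) (b₁ b₂ b₃ : ℂ)
    (g₀ g₁ g₂ g₃ : Equiv.Perm (ℂ × ℂ))
    (hg₀ : ∀ w z : ℂ, g₀ (w, z) = ((α : ℂ) * w, β * z))
    (hg₁ : ∀ w z : ℂ, g₁ (w, z) = (w + (a₁ : ℂ), z + b₁))
    (hg₂ : ∀ w z : ℂ, g₂ (w, z) = (w + (a₂ : ℂ), z + b₂))
    (hg₃ : ∀ w z : ℂ, g₃ (w, z) = (w + (a₃ : ℂ), z + b₃))
    (g : Equiv.Perm (ℂ × ℂ)) (hg : g ∈ Subgroup.closure {g₀, g₁, g₂, g₃})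
    (w z : ℂ) (hw : 0 < w.im) (hfix : g (w, z) = (w, z)) :
    g = 1 := by
  refine eq_one_of_mem_inoueAffineSubgroup hα hα1 hβ ?_ hw.ne' hfix
  refine (Subgroup.closure_le _).mpr ?_ hg
  rintro _ (rfl | rfl | rfl | rfl)
  · exact ⟨1, 0, 0, by simp [hg₀]⟩
  · exact ⟨0, a₁, b₁, by simp [hg₁]⟩
  · exact ⟨0, a₂, b₂, by simp [hg₂]⟩
  · exact ⟨0, a₃, b₃, by simp [hg₃]⟩
end

section
/- Let M be a 3×3 real matrix, α a real number, and β a complex number with Im β ≠ 0. Let a ∈ ℝ³ be a nonzero vector with M·a = α·a, and let b ∈ ℂ³ be a nonzero vector with M·b = β·b (M viewed as a complex matrix). Then the three vectors (a₁, b₁), (a₂, b₂), (a₃, b₃) ∈ ℝ × ℂ are linearly independent over ℝ. -/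
/-- A real matrix commutes with entrywise complex conjugation of vectors. -/
theorem Matrix.map_ofReal_mulVec_star {m n : Type*} [Fintype n] (M : Matrix m n ℝ) (v : n → ℂ) :
    (M.map (fun x : ℝ => (x : ℂ))).mulVec (star v) =
      star ((M.map (fun x : ℝ => (x : ℂ))).mulVec v) := by
  ext i
  simp [Matrix.mulVec, dotProduct]

/-- The vectors `(a₁,b₁), (a₂,b₂), (a₃,b₃) ∈ ℝ × ℂ` coming from a real eigenvector `a`
and a genuinely complex eigenvector `b` of a real 3×3 matrix are linearly independent
over `ℝ`. -/
theorem stmt_4 (M : Matrix (Fin 3) (Fin 3) ℝ) (α : ℝ) (β : ℂ) (hβ : β.im ≠ 0)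
    (a : Fin 3 → ℝ) (ha0 : a ≠ 0) (ha : M.mulVec a = α • a)
    (b : Fin 3 → ℂ) (hb0 : b ≠ 0)
    (hb : (M.map (fun x : ℝ => (x : ℂ))).mulVec b = β • b) :
    LinearIndependent ℝ (fun i : Fin 3 => ((a i, b i) : ℝ × ℂ)) := by
  set N := M.map (fun x : ℝ => (x : ℂ)) with hN
  set a' : Fin 3 → ℂ := fun i => (a i : ℂ) with ha'
  have ha'0 : a' ≠ 0 := fun h => ha0 (funext fun i => by simpa [ha'] using congrFun h i)
  have haN : N.mulVec a' = (α : ℂ) • a' := by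
    ext i
    have := congrArg (fun x : ℝ => (x : ℂ)) (congrFun ha i)
    simpa [Matrix.mulVec, dotProduct, hN, ha'] using this
  have hbN : N.mulVec (star b) = star β • star b := by
    rw [hN, Matrix.map_ofReal_mulVec_star, ← hN, hb, star_smul]
  have hinj : Function.Injective ![(α : ℂ), β, star β] := by
    have h1 : (α : ℂ) ≠ β := fun h => hβ (by simp [← h])
    have h2 : (α : ℂ) ≠ star β := fun h => hβ (by simpa using (congrArg Complex.im h).symm)
    have h3 : β ≠ star β := fun h => hβ (Complex.conj_eq_iff_im.mp h.symm)
    intro i j h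
    fin_cases i <;> fin_cases j <;> simp_all [eq_comm]
  have hli : LinearIndependent ℂ ![a', b, star b] := by
    refine Module.End.eigenvectors_linearIndependent' (Matrix.toLin' N) _ hinj _ fun i => ?_
    fin_cases i
    · exact ⟨Module.End.mem_eigenspace_iff.mpr haN, ha'0⟩
    · exact ⟨Module.End.mem_eigenspace_iff.mpr hb, hb0⟩
    · exact ⟨Module.End.mem_eigenspace_iff.mpr hbN, star_ne_zero.mpr hb0⟩
  have hunit : IsUnit (Matrix.of ![a', b, star b]) :=
    Matrix.linearIndependent_rows_iff_isUnit.mp hli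
  rw [Fintype.linearIndependent_iff]
  intro c hc
  have h1 : ∑ i, c i * a i = 0 := by
    simpa [Prod.fst_sum] using congrArg Prod.fst hc
  have h2 : ∑ i, (c i : ℂ) * b i = 0 := by
    simpa [Prod.snd_sum] using congrArg Prod.snd hc
  have h1' : ∑ i, (c i : ℂ) * a' i = 0 := by
    simp only [ha']
    exact_mod_cast h1
  have h3 : ∑ i, (c i : ℂ) * star (b i) = 0 := by
    simpa using congrArg star h2
  have hzero : (fun i => (c i : ℂ)) = 0 := by
    refine Matrix.mulVec_injective_iff_isUnit.mpr hunit ?_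
    rw [Matrix.mulVec_zero]
    ext j
    fin_cases j
    · simpa [Matrix.mulVec, dotProduct, mul_comm] using h1'
    · simpa [Matrix.mulVec, dotProduct, mul_comm] using h2
    · simpa [Matrix.mulVec, dotProduct, mul_comm] using h3
  intro i
  simpa using congrFun hzero i
end

section
/- Let a₁, a₂, b₁, b₂, c₁, c₂ be real numbers and r a nonzero integer. Define the bijections g₁, g₂, g₃ of ℂ × ℂ by gᵢ(w,z) = (w + aᵢ, z + bᵢ·w + cᵢ) for i = 1,2 and g₃(w,z) = (w, z + (a₂·b₁ − a₁·b₂)/r). Then in Equiv.Perm (ℂ × ℂ) the commutator satisfies g₁·g₂·g₁⁻¹·g₂⁻¹ = g₃^r, and g₃ commutes with both g₁ and g₂. In particular the commutator of g₁ and g₂ is independent of the constants c₁ and c₂. -/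
/-- Integer powers of a vertical translation of `α × M` are vertical translations. -/
theorem Equiv.Perm.zpow_apply_of_vertical_translation {α M : Type*} [AddCommGroup M]
    (g : Equiv.Perm (α × M)) (d : M) (hg : ∀ w z, g (w, z) = (w, z + d)) (n : ℤ) (w : α) (z : M) :
    (g ^ n) (w, z) = (w, z + n • d) := by
  have hg_inv : ∀ w z, g⁻¹ (w, z) = (w, z - d) := fun w z => by
    rw [Equiv.Perm.inv_eq_iff_eq, hg, sub_add_cancel]
  induction n generalizing z with
  | zero => simp
  | succ n ih =>
    rw [zpow_add_one, Equiv.Perm.mul_apply, hg, ih, add_zsmul, one_zsmul, add_assoc, add_comm d]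
  | pred n ih =>
    rw [zpow_sub_one, Equiv.Perm.mul_apply, hg_inv, ih, sub_zsmul, one_zsmul]
    congr 1
    abel

/-- The commutator relation `[g₁, g₂] = g₃^r` in the lattice of the Inoue surfaces
`S⁺_{N,p,q,r,t}`, together with the fact that `g₃` is central among `g₁, g₂, g₃`. -/
theorem stmt_8 (a₁ a₂ b₁ b₂ c₁ c₂ : ℝ) (r : ℤ) (hr : r ≠ 0)
    (g₁ g₂ g₃ : Equiv.Perm (ℂ × ℂ))
    (hg₁ : ∀ w z : ℂ, g₁ (w, z) = (w + (a₁ : ℂ), z + (b₁ : ℂ) * w + (c₁ : ℂ)))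
    (hg₂ : ∀ w z : ℂ, g₂ (w, z) = (w + (a₂ : ℂ), z + (b₂ : ℂ) * w + (c₂ : ℂ)))
    (hg₃ : ∀ w z : ℂ, g₃ (w, z) = (w, z + ((a₂ * b₁ - a₁ * b₂ : ℝ) : ℂ) / (r : ℂ))) :
    g₁ * g₂ * g₁⁻¹ * g₂⁻¹ = g₃ ^ r ∧ g₃ * g₁ = g₁ * g₃ ∧ g₃ * g₂ = g₂ * g₃ := by
  have hrC : (r : ℂ) ≠ 0 := Int.cast_ne_zero.mpr hr
  refine ⟨?_, ?_, ?_⟩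
  · rw [mul_inv_eq_iff_eq_mul, mul_inv_eq_iff_eq_mul]
    ext1 ⟨w, z⟩
    simp only [Equiv.Perm.mul_apply, hg₁, hg₂,
      Equiv.Perm.zpow_apply_of_vertical_translation g₃ _ hg₃, zsmul_eq_mul, mul_div_cancel₀ _ hrC]
    push_cast
    ext1 <;> ring
  · ext1 ⟨w, z⟩
    simp only [Equiv.Perm.mul_apply, hg₁, hg₃]
    ext1 <;> ring
  · ext1 ⟨w, z⟩
    simp only [Equiv.Perm.mul_apply, hg₂, hg₃]
    ext1 <;> ring
end

section
/- Let N = [n_{ij}] be a 2×2 integer matrix, α a real number with α > 1, and a = (a₁,a₂), b = (b₁,b₂) ∈ ℝ² vectors with N·a = α·a and N·b = α⁻¹·b. Let p, q be integers, r a nonzero integer, t a complex number, and c₁, c₂ real numbers. Define the bijections of ℂ × ℂ: g₀(w,z) = (α·w, z + t), gᵢ(w,z) = (w + aᵢ, z + bᵢ·w + cᵢ) for i = 1,2, and g₃(w,z) = (w, z + (a₂·b₁ − a₁·b₂)/r). Then the two relations g₀·g₁·g₀⁻¹ = g₁^{n₁₁}·g₂^{n₁₂}·g₃^p and g₀·g₂·g₀⁻¹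 = g₁^{n₂₁}·g₂^{n₂₂}·g₃^q hold in Equiv.Perm (ℂ × ℂ) if and only if (I − N)·(c₁,c₂)ᵀ = (e₁,e₂)ᵀ + ((a₂·b₁ − a₁·b₂)/r)·(p,q)ᵀ, where eᵢ = ½·n_{i1}·(n_{i1} − 1)·a₁·b₁ + ½·n_{i2}·(n_{i2} − 1)·a₂·b₂ + n_{i1}·n_{i2}·a₂·b₁. (This is the characterization of the constants c₁, c₂ in the construction of the Inoue surface S⁺_{N,p,q,r,t}.) -/
/-- Integer powers of the map `(w, z) ↦ (w + a, z + b w + c)`. -/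
theorem zpow_apply_of_affine_shear {g : Equiv.Perm (ℂ × ℂ)} {a b c : ℂ}
    (hg : ∀ w z : ℂ, g (w, z) = (w + a, z + b * w + c)) (n : ℤ) (w z : ℂ) :
    (g ^ n) (w, z) = (w + n * a, z + n * b * w + n * c + n * (n - 1) / 2 * (a * b)) := by
  induction n generalizing w z with
  | zero => simp
  | succ n ih =>
    rw [zpow_add_one, Equiv.Perm.mul_apply, hg, ih]
    push_cast
    ext <;> simp only <;> ring
  | pred n ih =>
    have hinv : g⁻¹ (w, z) = (w - a, z - b * (w - a) - c) := by
      rw [Equiv.Perm.inv_eq_iff_eq, hg]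
      ext <;> simp only <;> ring
    rw [zpow_sub_one, Equiv.Perm.mul_apply, hinv, ih]
    push_cast
    ext <;> simp only <;> ring

/-- A single conjugation relation between affine shears of `ℂ × ℂ` holds iff the constant terms
agree, provided that the translation parts and the linear parts already match. -/
theorem conj_eq_zpow_mul_zpow_mul_zpow_iff {g₀ g g₁ g₂ g₃ : Equiv.Perm (ℂ × ℂ)}
    {α t a b c a₁ b₁ c₁ a₂ b₂ c₂ s : ℂ} (hα : α ≠ 0)
    (hg₀ : ∀ w z : ℂ, g₀ (w, z) = (α * w, z + t))
    (hg : ∀ w z : ℂ, g (w, z) = (w + a, z + b * w + c))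
    (hg₁ : ∀ w z : ℂ, g₁ (w, z) = (w + a₁, z + b₁ * w + c₁))
    (hg₂ : ∀ w z : ℂ, g₂ (w, z) = (w + a₂, z + b₂ * w + c₂))
    (hg₃ : ∀ w z : ℂ, g₃ (w, z) = (w, z + s))
    {m n : ℤ} (k : ℤ) (ha : m * a₁ + n * a₂ = α * a) (hb : m * b₁ + n * b₂ = α⁻¹ * b) :
    g₀ * g * g₀⁻¹ = g₁ ^ m * g₂ ^ n * g₃ ^ k ↔
      c = m * c₁ + n * c₂ + (m * (m - 1) / 2 * (a₁ * b₁) + n * (n - 1) / 2 * (a₂ * b₂)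
        + m * n * (a₂ * b₁)) + k * s := by
  have hg₃' : ∀ w z : ℂ, g₃ (w, z) = (w + 0, z + 0 * w + s) := by simpa using hg₃
  have hinv : ∀ w z : ℂ, g₀⁻¹ (w, z) = (α⁻¹ * w, z - t) := by
    intro w z
    rw [Equiv.Perm.inv_eq_iff_eq, hg₀, mul_inv_cancel_left₀ hα, sub_add_cancel]
  have hl : ∀ w z : ℂ, (g₀ * g * g₀⁻¹) (w, z) = (w + α * a, z + α⁻¹ * b * w + c) := by
    intro w z
    rw [Equiv.Perm.mul_apply, Equiv.Perm.mul_apply, hinv, hg, hg₀, mul_add,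
      mul_inv_cancel_left₀ hα]
    ext <;> simp only <;> ring
  have hr : ∀ w z : ℂ, (g₁ ^ m * g₂ ^ n * g₃ ^ k) (w, z) =
      (w + α * a, z + α⁻¹ * b * w + (m * c₁ + n * c₂ + (m * (m - 1) / 2 * (a₁ * b₁)
        + n * (n - 1) / 2 * (a₂ * b₂) + m * n * (a₂ * b₁)) + k * s)) := by
    intro w z
    rw [Equiv.Perm.mul_apply, Equiv.Perm.mul_apply, zpow_apply_of_affine_shear hg₃',
      zpow_apply_of_affine_shear hg₂, zpow_apply_of_affine_shear hg₁, ← ha, ← hb]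
    ext <;> simp only <;> ring
  constructor
  · intro h
    have h0 := congrArg Prod.snd (DFunLike.congr_fun h (0, 0))
    rw [hl, hr] at h0
    exact add_left_cancel h0
  · intro h
    refine Equiv.ext fun ⟨w, z⟩ => ?_
    rw [hl, hr, ← h]

/-- Characterization of the constants `c₁, c₂` in the construction of the Inoue surface
`S⁺_{N,p,q,r,t}`: the relations `g₀g₁g₀⁻¹ = g₁^{n₁₁}g₂^{n₁₂}g₃^p` and
`g₀g₂g₀⁻¹ = g₁^{n₂₁}g₂^{n₂₂}g₃^q` hold iff
`(I − N)(c₁,c₂)ᵀ = (e₁,e₂)ᵀ + (1/r)(a₂b₁ − a₁b₂)(p,q)ᵀ`. -/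
theorem stmt_9 (N : Matrix (Fin 2) (Fin 2) ℤ) (α : ℝ) (hα : 1 < α)
    (a b : Fin 2 → ℝ)
    (ha : (N.map (Int.cast : ℤ → ℝ)).mulVec a = α • a)
    (hb : (N.map (Int.cast : ℤ → ℝ)).mulVec b = α⁻¹ • b)
    (p q r : ℤ) (hr : r ≠ 0) (t : ℂ) (c₁ c₂ : ℝ)
    (g₀ g₁ g₂ g₃ : Equiv.Perm (ℂ × ℂ))
    (hg₀ : ∀ w z : ℂ, g₀ (w, z) = ((α : ℂ) * w, z + t))
    (hg₁ : ∀ w z : ℂ, g₁ (w, z) = (w + (a 0 : ℂ), z + (b 0 : ℂ) * w + (c₁ : ℂ)))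
    (hg₂ : ∀ w z : ℂ, g₂ (w, z) = (w + (a 1 : ℂ), z + (b 1 : ℂ) * w + (c₂ : ℂ)))
    (hg₃ : ∀ w z : ℂ, g₃ (w, z) =
      (w, z + ((a 1 * b 0 - a 0 * b 1 : ℝ) : ℂ) / (r : ℂ))) :
    (g₀ * g₁ * g₀⁻¹ = g₁ ^ (N 0 0) * g₂ ^ (N 0 1) * g₃ ^ p ∧
        g₀ * g₂ * g₀⁻¹ = g₁ ^ (N 1 0) * g₂ ^ (N 1 1) * g₃ ^ q) ↔
      ((1 : Matrix (Fin 2) (Fin 2) ℝ) - N.map (Int.cast : ℤ → ℝ)).mulVec ![c₁, c₂] =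
        (fun i : Fin 2 =>
            (1 / 2 : ℝ) * (N i 0 : ℝ) * ((N i 0 : ℝ) - 1) * (a 0 * b 0)
              + (1 / 2 : ℝ) * (N i 1 : ℝ) * ((N i 1 : ℝ) - 1) * (a 1 * b 1)
              + (N i 0 : ℝ) * (N i 1 : ℝ) * (a 1 * b 0))
          + ((a 1 * b 0 - a 0 * b 1) / (r : ℝ)) • ![(p : ℝ), (q : ℝ)] := by
  have hα0 : (α : ℂ) ≠ 0 := Complex.ofReal_ne_zero.mpr (by linarith)
  have hrowa : ∀ i, ((N i 0 : ℤ) : ℂ) * (a 0 : ℂ) + (N i 1 : ℤ) * (a 1 : ℂ) = α * (a i : ℂ) := by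
    intro i
    have h := congrFun ha i
    simp only [Matrix.mulVec, dotProduct, Fin.sum_univ_two, Matrix.map_apply, Pi.smul_apply,
      smul_eq_mul] at h
    exact_mod_cast h
  have hrowb : ∀ i, ((N i 0 : ℤ) : ℂ) * (b 0 : ℂ) + (N i 1 : ℤ) * (b 1 : ℂ) =
      (α : ℂ)⁻¹ * (b i : ℂ) := by
    intro i
    have h := congrFun hb i
    simp only [Matrix.mulVec, dotProduct, Fin.sum_univ_two, Matrix.map_apply, Pi.smul_apply,
      smul_eq_mul] at h
    exact_mod_cast h
  rw [conj_eq_zpow_mul_zpow_mul_zpow_iff hα0 hg₀ hg₁ hg₁ hg₂ hg₃ p (hrowa 0) (hrowb 0),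
    conj_eq_zpow_mul_zpow_mul_zpow_iff hα0 hg₀ hg₂ hg₁ hg₂ hg₃ q (hrowa 1) (hrowb 1),
    Matrix.sub_mulVec, Matrix.one_mulVec, funext_iff, Fin.forall_fin_two]
  simp only [Matrix.mulVec, dotProduct, Fin.sum_univ_two,
    Matrix.map_apply, Pi.sub_apply, Pi.add_apply, Pi.smul_apply, smul_eq_mul,
    Matrix.cons_val_zero, Matrix.cons_val_one]
  norm_cast
  constructor <;> rintro ⟨h₁, h₂⟩ <;> constructor <;> push_cast at h₁ h₂ ⊢ <;> linarith
end

section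
/- Let α be a real number with α > 0 and α ≠ 1, t a complex number, a₁, a₂, b₁, b₂, c₁, c₂ real numbers, and r a nonzero integer. Define the bijections of ℂ × ℂ: g₀(w,z) = (α·w, z + t), gᵢ(w,z) = (w + aᵢ, z + bᵢ·w + cᵢ) for i = 1,2, and g₃(w,z) = (w, z + (a₂·b₁ − a₁·b₂)/r). If an element g of the subgroup of Equiv.Perm (ℂ × ℂ) generated by {g₀, g₁, g₂, g₃} fixes some point (w,z) with Im w > 0, then g is the identity permutation. (This is the freeness of the action of the group defining an Inoue surface of type S⁺_{N,p,q,r,t} on ℍ × ℂ.) -/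
/-- The bijection `g` of `ℂ × ℂ` has the form
`(w, z) ↦ (αⁿ w + a, z + b w + c + n t)` with `n` an integer and `a`, `b`, `c` real. -/
def IsSkewAffine (α : ℝ) (t : ℂ) (g : Equiv.Perm (ℂ × ℂ)) : Prop :=
  ∃ (n : ℤ) (a b c : ℝ), ∀ w z : ℂ,
    g (w, z) = ((α : ℂ) ^ n * w + a, z + b * w + c + n * t)

namespace IsSkewAffine

variable {α : ℝ} {t : ℂ} {f g : Equiv.Perm (ℂ × ℂ)}

theorem one : IsSkewAffine α t 1 := ⟨0, 0, 0, 0, fun w z => by simp⟩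

theorem mul (hα : α ≠ 0) (hf : IsSkewAffine α t f) (hg : IsSkewAffine α t g) :
    IsSkewAffine α t (f * g) := by
  obtain ⟨n, a, b, c, hf⟩ := hf
  obtain ⟨m, a', b', c', hg⟩ := hg
  have hα' : (α : ℂ) ≠ 0 := by exact_mod_cast hα
  refine ⟨n + m, α ^ n * a' + a, b' + b * α ^ m, c' + b * a' + c, fun w z => ?_⟩
  rw [Equiv.Perm.mul_apply, hg, hf, zpow_add₀ hα']
  push_cast
  ext1 <;> ring

theorem inv (hα : α ≠ 0) (hg : IsSkewAffine α t g) : IsSkewAffine α t g⁻¹ := by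
  obtain ⟨n, a, b, c, hg⟩ := hg
  have hα' : (α : ℂ) ^ n ≠ 0 := zpow_ne_zero _ (by exact_mod_cast hα)
  refine ⟨-n, -((α ^ n)⁻¹ * a), -(b * (α ^ n)⁻¹), b * (α ^ n)⁻¹ * a - c, fun w z => ?_⟩
  rw [Equiv.Perm.inv_eq_iff_eq, hg, zpow_neg]
  push_cast
  ext1
  · field_simp
    ring
  · ring

theorem of_mem_closure (hα : α ≠ 0) {s : Set (Equiv.Perm (ℂ × ℂ))}
    (hs : ∀ f ∈ s, IsSkewAffine α t f) (hg : g ∈ Subgroup.closure s) :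
    IsSkewAffine α t g := by
  induction hg using Subgroup.closure_induction with
  | mem f hf => exact hs f hf
  | one => exact one
  | mul f g _ _ hf hg => exact hf.mul hα hg
  | inv f _ hf => exact hf.inv hα

theorem eq_one_of_fixed_point (hα : 0 < α) (hα1 : α ≠ 1) (hg : IsSkewAffine α t g)
    {w z : ℂ} (hw : 0 < w.im) (hfix : g (w, z) = (w, z)) : g = 1 := by
  obtain ⟨n, a, b, c, hg⟩ := hg
  rw [hg, Prod.mk.injEq] at hfix
  obtain ⟨h₁, h₂⟩ := hfix
  have hn : n = 0 := by
    have him := congrArg Complex.im h₁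
    rw [← Complex.ofReal_zpow, Complex.add_im, Complex.im_ofReal_mul,
      Complex.ofReal_im, add_zero] at him
    exact (zpow_eq_one_iff_right₀ hα.le hα1).1 (mul_right_cancel₀ hw.ne' (him.trans (one_mul _).symm))
  subst hn
  have ha : a = 0 := by simpa using h₁
  have hbc : (b : ℂ) * w + c = 0 := by
    simpa [add_assoc] using h₂
  have hb : b = 0 := by simpa [hw.ne'] using congrArg Complex.im hbc
  have hc : c = 0 := by simpa [hb] using hbc
  ext1 ⟨w, z⟩
  simp [hg, ha, hb, hc]

end IsSkewAffine

/-- Freeness of the action of the group defining an Inoue surface of type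
`S⁺_{N,p,q,r,t}` on `ℍ × ℂ`. -/
theorem stmt_11 (α : ℝ) (hα : 0 < α) (hα1 : α ≠ 1) (t : ℂ)
    (a₁ a₂ b₁ b₂ c₁ c₂ : ℝ) (r : ℤ) (hr : r ≠ 0)
    (g₀ g₁ g₂ g₃ : Equiv.Perm (ℂ × ℂ))
    (hg₀ : ∀ w z : ℂ, g₀ (w, z) = ((α : ℂ) * w, z + t))
    (hg₁ : ∀ w z : ℂ, g₁ (w, z) = (w + (a₁ : ℂ), z + (b₁ : ℂ) * w + (c₁ : ℂ)))
    (hg₂ : ∀ w z : ℂ, g₂ (w, z) = (w + (a₂ : ℂ), z + (b₂ : ℂ) * w + (c₂ : ℂ)))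
    (hg₃ : ∀ w z : ℂ, g₃ (w, z) = (w, z + ((a₂ * b₁ - a₁ * b₂ : ℝ) : ℂ) / (r : ℂ)))
    (g : Equiv.Perm (ℂ × ℂ)) (hg : g ∈ Subgroup.closure {g₀, g₁, g₂, g₃})
    (w z : ℂ) (hw : 0 < w.im) (hfix : g (w, z) = (w, z)) :
    g = 1 := by
  refine (IsSkewAffine.of_mem_closure (t := t) hα.ne' ?_ hg).eq_one_of_fixed_point hα hα1 hw hfix
  rintro f (rfl | rfl | rfl | rfl)
  · exact ⟨1, 0, 0, 0, fun w z => by simp [hg₀]⟩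
  · exact ⟨0, a₁, b₁, c₁, fun w z => by simp [hg₁]⟩
  · exact ⟨0, a₂, b₂, c₂, fun w z => by simp [hg₂]⟩
  · exact ⟨0, 0, 0, (a₂ * b₁ - a₁ * b₂) / r, fun w z => by simp [hg₃]⟩
end

section
/- Let N = [n_{ij}] be a 2×2 integer matrix, α a real number with α > 1, and a = (a₁,a₂), b = (b₁,b₂) ∈ ℝ² with N·a = α·a and N·b = −α⁻¹·b. Let p, q be integers, r a nonzero integer, and c₁, c₂ real numbers. Define the bijections of ℂ × ℂ: g₀(w,z) = (α·w, −z), gᵢ(w,z) = (w + aᵢ, z + bᵢ·w + cᵢ) for i = 1,2, and g₃(w,z) = (w, z + (a₂·b₁ − a₁·b₂)/r). Then: (1) the two relations g₀·g₁·g₀⁻¹ = g₁^{n₁₁}·g₂^{n₁₂}·g₃^p and g₀·g₂·g₀⁻¹ = g₁^{n₂₁}·g₂^{n₂₂}·g₃^q hold in Equiv.Perm (ℂ × ℂ) if and only if (−I − N)·(c₁,c₂)ᵀ = (e₁,e₂)ᵀ + ((a₂·b₁ − a₁·b₂)/r)·(p,q)ᵀ, where eᵢ = ½·n_{i1}·(n_{i1}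 − 1)·a₁·b₁ + ½·n_{i2}·(n_{i2} − 1)·a₂·b₂ + n_{i1}·n_{i2}·a₂·b₁; and (2) g₀·g₃·g₀⁻¹ = g₃⁻¹. (This is the characterization of the constants c₁, c₂ in the construction of the Inoue surface S⁻_{N,p,q,r}.) -/
/-- Integer powers of the shear `(w, z) ↦ (w + a, z + b w + c)`. -/
lemma zpow_shear_apply {K : Type*} [Field K] [CharZero K] (g : Equiv.Perm (K × K)) (a b c : K)
    (hg : ∀ w z, g (w, z) = (w + a, z + b * w + c)) (n : ℤ) (w z : K) :
    (g ^ n) (w, z) =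
      (w + n * a, z + n * b * w + (1 / 2 * n * (n - 1) * (a * b) + n * c)) := by
  induction n generalizing w z with
  | zero => simp
  | succ n ih =>
    rw [zpow_add_one, Equiv.Perm.mul_apply, hg, ih]
    ext <;> push_cast <;> ring
  | pred n ih =>
    have hinv : g⁻¹ (w, z) = (w - a, z - b * (w - a) - c) := by
      rw [Equiv.Perm.inv_eq_iff_eq, hg]
      ext <;> ring
    rw [zpow_sub_one, Equiv.Perm.mul_apply, hinv, ih]
    ext <;> push_cast <;> ring

/-- A conjugated shear is a product of powers of shears iff the constant terms agree, provided the
translation parts and the slopes do. -/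
lemma conj_shear_eq_iff {K : Type*} [Field K] [CharZero K] (g₀ g g₁ g₂ g₃ : Equiv.Perm (K × K))
    (α a b c a₁ b₁ c₁ a₂ b₂ c₂ k : K) (hα : α ≠ 0)
    (hg₀ : ∀ w z, g₀ (w, z) = (α * w, -z))
    (hg : ∀ w z, g (w, z) = (w + a, z + b * w + c))
    (hg₁ : ∀ w z, g₁ (w, z) = (w + a₁, z + b₁ * w + c₁))
    (hg₂ : ∀ w z, g₂ (w, z) = (w + a₂, z + b₂ * w + c₂))
    (hg₃ : ∀ w z, g₃ (w, z) = (w, z + k)) (m n p : ℤ)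
    (ha : m * a₁ + n * a₂ = α * a) (hb : m * b₁ + n * b₂ = -α⁻¹ * b) :
    g₀ * g * g₀⁻¹ = g₁ ^ m * g₂ ^ n * g₃ ^ p ↔
      -c - (m * c₁ + n * c₂) = 1 / 2 * m * (m - 1) * (a₁ * b₁) + 1 / 2 * n * (n - 1) * (a₂ * b₂)
        + m * n * (a₂ * b₁) + k * p := by
  have hconj (w z : K) : (g₀ * g) (w, z) = (α * w + α * a, -z - b * w - c) := by
    rw [Equiv.Perm.mul_apply, hg, hg₀]
    ext <;> ring
  have hprod (w z : K) : (g₁ ^ m * g₂ ^ n * g₃ ^ p * g₀) (w, z) =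
      (α * w + α * a, -z - b * w + (1 / 2 * m * (m - 1) * (a₁ * b₁)
        + 1 / 2 * n * (n - 1) * (a₂ * b₂) + m * n * (a₂ * b₁) + k * p + (m * c₁ + n * c₂))) := by
    have hbα : (m * b₁ + n * b₂) * α = -b := by rw [hb]; field_simp
    simp only [Equiv.Perm.mul_apply]
    rw [hg₀, zpow_shear_apply g₃ 0 0 k (by simpa using hg₃), zpow_shear_apply g₂ _ _ _ hg₂,
      zpow_shear_apply g₁ _ _ _ hg₁]
    ext
    · linear_combination ha
    · linear_combination w * hbα
  rw [mul_inv_eq_iff_eq_mul]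
  constructor
  · intro h
    have h0 := congrArg Prod.snd (DFunLike.congr_fun h (0, 0))
    rw [hconj, hprod] at h0
    linear_combination h0
  · intro h
    ext1 ⟨w, z⟩
    rw [hconj, hprod]
    ext
    · rfl
    · linear_combination h


/-- Characterization of the constants `c₁, c₂` in the construction of the Inoue surface
`S⁻_{N,p,q,r}`: the relations `g₀g₁g₀⁻¹ = g₁^{n₁₁}g₂^{n₁₂}g₃^p` and
`g₀g₂g₀⁻¹ = g₁^{n₂₁}g₂^{n₂₂}g₃^q` hold iff
`(−I − N)(c₁,c₂)ᵀ = (e₁,e₂)ᵀ + (1/r)(a₂b₁ − a₁b₂)(p,q)ᵀ`; moreover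
`g₀g₃g₀⁻¹ = g₃⁻¹`. -/
theorem stmt_12 (N : Matrix (Fin 2) (Fin 2) ℤ) (α : ℝ) (hα : 1 < α)
    (a b : Fin 2 → ℝ)
    (ha : (N.map (Int.cast : ℤ → ℝ)).mulVec a = α • a)
    (hb : (N.map (Int.cast : ℤ → ℝ)).mulVec b = (-α⁻¹) • b)
    (p q r : ℤ) (hr : r ≠ 0) (c₁ c₂ : ℝ)
    (g₀ g₁ g₂ g₃ : Equiv.Perm (ℂ × ℂ))
    (hg₀ : ∀ w z : ℂ, g₀ (w, z) = ((α : ℂ) * w, -z))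
    (hg₁ : ∀ w z : ℂ, g₁ (w, z) = (w + (a 0 : ℂ), z + (b 0 : ℂ) * w + (c₁ : ℂ)))
    (hg₂ : ∀ w z : ℂ, g₂ (w, z) = (w + (a 1 : ℂ), z + (b 1 : ℂ) * w + (c₂ : ℂ)))
    (hg₃ : ∀ w z : ℂ, g₃ (w, z) =
      (w, z + ((a 1 * b 0 - a 0 * b 1 : ℝ) : ℂ) / (r : ℂ))) :
    ((g₀ * g₁ * g₀⁻¹ = g₁ ^ (N 0 0) * g₂ ^ (N 0 1) * g₃ ^ p ∧
        g₀ * g₂ * g₀⁻¹ = g₁ ^ (N 1 0) * g₂ ^ (N 1 1) * g₃ ^ q) ↔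
      (-(1 : Matrix (Fin 2) (Fin 2) ℝ) - N.map (Int.cast : ℤ → ℝ)).mulVec ![c₁, c₂] =
        (fun i : Fin 2 =>
            (1 / 2 : ℝ) * (N i 0 : ℝ) * ((N i 0 : ℝ) - 1) * (a 0 * b 0)
              + (1 / 2 : ℝ) * (N i 1 : ℝ) * ((N i 1 : ℝ) - 1) * (a 1 * b 1)
              + (N i 0 : ℝ) * (N i 1 : ℝ) * (a 1 * b 0))
          + ((a 1 * b 0 - a 0 * b 1) / (r : ℝ)) • ![(p : ℝ), (q : ℝ)]) ∧
      g₀ * g₃ * g₀⁻¹ = g₃⁻¹ := by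
  have hα0 : (α : ℂ) ≠ 0 := by exact_mod_cast (zero_lt_one.trans hα).ne'
  have ha' (i : Fin 2) : (N i 0 : ℂ) * a 0 + N i 1 * a 1 = α * a i := by
    have h := congrFun ha i
    simp only [Matrix.mulVec, dotProduct, Fin.sum_univ_two, Matrix.map_apply, Pi.smul_apply,
      smul_eq_mul] at h
    exact_mod_cast h
  have hb' (i : Fin 2) : (N i 0 : ℂ) * b 0 + N i 1 * b 1 = -(α : ℂ)⁻¹ * b i := by
    have h := congrFun hb i
    simp only [Matrix.mulVec, dotProduct, Fin.sum_univ_two, Matrix.map_apply, Pi.smul_apply,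
      smul_eq_mul] at h
    exact_mod_cast h
  refine ⟨?_, ?_⟩
  · rw [conj_shear_eq_iff g₀ g₁ g₁ g₂ g₃ α _ _ _ _ _ _ _ _ _ _ hα0 hg₀ hg₁ hg₁ hg₂ hg₃ _ _ _
        (ha' 0) (hb' 0),
      conj_shear_eq_iff g₀ g₂ g₁ g₂ g₃ α _ _ _ _ _ _ _ _ _ _ hα0 hg₀ hg₂ hg₁ hg₂ hg₃ _ _ _
        (ha' 1) (hb' 1),
      Matrix.sub_mulVec, Matrix.neg_mulVec, Matrix.one_mulVec, funext_iff, Fin.forall_fin_two]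
    simp only [Pi.sub_apply, Pi.neg_apply,
      Pi.add_apply, Pi.smul_apply, smul_eq_mul, Matrix.mulVec, dotProduct, Fin.sum_univ_two,
      Matrix.map_apply, Matrix.cons_val_zero, Matrix.cons_val_one,
      ← Complex.ofReal_inj]
    push_cast
    rfl
  · rw [mul_inv_eq_iff_eq_mul, eq_inv_mul_iff_mul_eq]
    ext1 ⟨w, z⟩
    simp only [Equiv.Perm.mul_apply, hg₀, hg₃]
    ext
    · rfl
    · ring
end

section
/- Let N = [n_{ij}] be a 2×2 integer matrix with determinant −1, α a real number with α > 1, and a = (a₁,a₂), b = (b₁,b₂) ∈ ℝ² with N·a = α·a and N·b = −α⁻¹·b. Let p, q be integers, r a nonzero integer, and suppose c₁, c₂ are real numbers satisfying (−I − N)·(c₁,c₂)ᵀ = (e₁,e₂)ᵀ + ((a₂·b₁ − a₁·b₂)/r)·(p,q)ᵀ, where eᵢ = ½·n_{i1}·(n_{i1} − 1)·a₁·b₁ + ½·n_{i2}·(n_{i2} − 1)·a₂·b₂ + n_{i1}·n_{i2}·a₂·b₁. Define the bijections of ℂ × ℂ: g₀(w,z) = (α·w, −z), gᵢ(w,z)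 = (w + aᵢ, z + bᵢ·w + cᵢ) for i = 1,2, and g₃(w,z) = (w, z + (a₂·b₁ − a₁·b₂)/r). Let G be the subgroup of Equiv.Perm (ℂ × ℂ) generated by {g₀, g₁, g₂, g₃} and H the subgroup generated by {g₀², g₁, g₂, g₃}. Then H ≤ G and H has index 2 in G (formally, (H.subgroupOf G).index = 2). (This is the group-theoretic content of the statement that an Inoue surface S⁺_{N²,p₁,q₁,r,0} double covers S⁻_{N,p,q,r}.) -/
/-- Adjoining a square root `g` of an element of `H`, where `g` lies outside `H` and conjugates `S`
into `H = ⟨g², S⟩`, yields a group containing `H` with index two. -/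
lemma Subgroup.index_closure_insert_sq_eq_two {G : Type*} [Group G] (g : G) (S : Set G)
    (hconj : ∀ s ∈ S, g * s * g⁻¹ ∈ closure (insert (g ^ 2) S))
    (hg : g ∉ closure (insert (g ^ 2) S)) :
    closure (insert (g ^ 2) S) ≤ closure (insert g S) ∧
      ((closure (insert (g ^ 2) S)).subgroupOf (closure (insert g S))).index = 2 := by
  set H := closure (insert (g ^ 2) S) with hH
  have hsq : g ^ 2 ∈ H := subset_closure (Set.mem_insert _ _)
  have hS : ∀ s ∈ S, s ∈ H := fun s hs => subset_closure (Set.mem_insert_of_mem _ hs)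
  have hgK : g ∈ closure (insert g S) := subset_closure (Set.mem_insert _ _)
  have conj_mem : ∀ x ∈ H, g * x * g⁻¹ ∈ H := by
    have hle : H ≤ H.comap (MulAut.conj g).toMonoidHom := by
      rw [hH, closure_le, ← hH]
      rintro x (rfl | hx)
      · simpa [pow_two, mul_assoc] using hsq
      · simpa using hconj x hx
    intro x hx
    simpa using hle hx
  have conj_inv_mem : ∀ x ∈ H, g⁻¹ * x * g ∈ H := by
    intro x hx
    have h := H.mul_mem (H.mul_mem (H.inv_mem hsq) (conj_mem x hx)) hsq
    convert h using 1
    group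
  have cover : ∀ x ∈ closure (insert g S), x ∈ H ∨ x * g ∈ H := by
    intro x hx
    induction hx using closure_induction_left with
    | one => exact Or.inl H.one_mem
    | mul_left s hs y _ ih =>
      rcases hs with rfl | hs
      · rcases ih with ih | ih
        · right
          convert H.mul_mem (conj_mem y ih) hsq using 1
          group
        · left
          convert conj_mem _ ih using 1
          group
      · simpa only [mul_assoc, H.mul_mem_cancel_left (hS s hs)] using ih
    | inv_mul_cancel s hs y _ ih =>
      rcases hs with rfl | hs
      · rcases ih with ih | ih
        · exact Or.inr (conj_inv_mem y ih)
        · left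
          convert H.mul_mem (H.inv_mem hsq) (conj_mem _ ih) using 1
          group
      · simpa only [mul_assoc, H.mul_mem_cancel_left (H.inv_mem (hS s hs))] using ih
  refine ⟨?_, ?_⟩
  · rw [hH, closure_le]
    rintro x (rfl | hx)
    · exact pow_mem hgK 2
    · exact subset_closure (Set.mem_insert_of_mem _ hx)
  · rw [index_eq_two_iff]
    refine ⟨⟨g, hgK⟩, fun x => ?_⟩
    simp only [mem_subgroupOf, coe_mul]
    rcases cover x x.2 with hx | hx
    · exact Or.inr ⟨hx, fun h => hg ((H.mul_mem_cancel_left hx).1 h)⟩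
    · exact Or.inl ⟨hx, fun h => hg ((H.mul_mem_cancel_left h).1 hx)⟩

/-- Integer powers of the affine map `(w, z) ↦ (w + s, z + β w + γ)`. -/
lemma zpow_apply_of_affine {g : Equiv.Perm (ℂ × ℂ)} {s β γ : ℂ}
    (hg : ∀ w z : ℂ, g (w, z) = (w + s, z + β * w + γ)) (m : ℤ) (w z : ℂ) :
    (g ^ m) (w, z) =
      (w + m * s, z + m * β * w + (m * γ + 1 / 2 * m * (m - 1) * (s * β))) := by
  have hinv : ∀ w z : ℂ, g⁻¹ (w, z) = (w - s, z - β * (w - s) - γ) := by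
    intro w z
    rw [Equiv.Perm.inv_eq_iff_eq, hg]
    exact Prod.ext (by ring) (by ring)
  induction m using Int.induction_on generalizing w z with
  | zero => simp
  | succ m ih =>
    rw [zpow_add_one, Equiv.Perm.mul_apply, hg, ih]
    ext <;> push_cast <;> ring
  | pred m ih =>
    rw [zpow_sub_one, Equiv.Perm.mul_apply, hinv, ih]
    ext <;> push_cast <;> ring


/-- The subgroup generated by `g₀², g₁, g₂, g₃` has index 2 in the group generated by
`g₀, g₁, g₂, g₃` defining the Inoue surface `S⁻_{N,p,q,r}`; this is the group-theoretic
content of the fact that `S⁺_{N²,p₁,q₁,r,0}` double covers `S⁻_{N,p,q,r}`. -/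
theorem stmt_13 (N : Matrix (Fin 2) (Fin 2) ℤ) (hdet : N.det = -1) (α : ℝ) (hα : 1 < α)
    (a b : Fin 2 → ℝ)
    (ha : (N.map (Int.cast : ℤ → ℝ)).mulVec a = α • a)
    (hb : (N.map (Int.cast : ℤ → ℝ)).mulVec b = (-α⁻¹) • b)
    (p q r : ℤ) (hr : r ≠ 0) (c₁ c₂ : ℝ)
    (hc : (-(1 : Matrix (Fin 2) (Fin 2) ℝ) - N.map (Int.cast : ℤ → ℝ)).mulVec ![c₁, c₂] =
      (fun i : Fin 2 =>
          (1 / 2 : ℝ) * (N i 0 : ℝ) * ((N i 0 : ℝ) - 1) * (a 0 * b 0)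
            + (1 / 2 : ℝ) * (N i 1 : ℝ) * ((N i 1 : ℝ) - 1) * (a 1 * b 1)
            + (N i 0 : ℝ) * (N i 1 : ℝ) * (a 1 * b 0))
        + ((a 1 * b 0 - a 0 * b 1) / (r : ℝ)) • ![(p : ℝ), (q : ℝ)])
    (g₀ g₁ g₂ g₃ : Equiv.Perm (ℂ × ℂ))
    (hg₀ : ∀ w z : ℂ, g₀ (w, z) = ((α : ℂ) * w, -z))
    (hg₁ : ∀ w z : ℂ, g₁ (w, z) = (w + (a 0 : ℂ), z + (b 0 : ℂ) * w + (c₁ : ℂ)))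
    (hg₂ : ∀ w z : ℂ, g₂ (w, z) = (w + (a 1 : ℂ), z + (b 1 : ℂ) * w + (c₂ : ℂ)))
    (hg₃ : ∀ w z : ℂ, g₃ (w, z) =
      (w, z + ((a 1 * b 0 - a 0 * b 1 : ℝ) : ℂ) / (r : ℂ))) :
    Subgroup.closure {g₀ ^ 2, g₁, g₂, g₃} ≤ Subgroup.closure {g₀, g₁, g₂, g₃} ∧
      ((Subgroup.closure {g₀ ^ 2, g₁, g₂, g₃}).subgroupOf
        (Subgroup.closure {g₀, g₁, g₂, g₃})).index = 2 := by
  have hα0 : (α : ℂ) ≠ 0 := by exact_mod_cast (by linarith : α ≠ 0)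
  have hg₀inv : ∀ w z : ℂ, g₀⁻¹ (w, z) = ((α : ℂ)⁻¹ * w, -z) := by
    intro w z
    rw [Equiv.Perm.inv_eq_iff_eq, hg₀]
    simp [hα0]
  set θ : ℝ := (a 1 * b 0 - a 0 * b 1) / (r : ℝ) with hθ
  replace hg₃ : ∀ w z : ℂ, g₃ (w, z) = (w + 0, z + 0 * w + (θ : ℂ)) := by
    intro w z
    rw [hg₃, hθ]
    simp
  have hmem : ∀ g ∈ ({g₁, g₂, g₃} : Set (Equiv.Perm (ℂ × ℂ))),
      g ∈ Subgroup.closure {g₀ ^ 2, g₁, g₂, g₃} :=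
    fun g hg => Subgroup.subset_closure (Set.mem_insert_of_mem _ hg)
  have conj_mem : ∀ (i : Fin 2) (g : Equiv.Perm (ℂ × ℂ)) (k : ℤ),
      (∀ w z : ℂ, g (w, z) = (w + (a i : ℂ), z + (b i : ℂ) * w + (![c₁, c₂] i : ℝ))) →
      ![(p : ℝ), (q : ℝ)] i = k →
      g₀ * g * g₀⁻¹ ∈ Subgroup.closure {g₀ ^ 2, g₁, g₂, g₃} := by
    intro i g k hg hk
    have ha' := congrFun ha i
    have hb' := congrFun hb i
    have hc' := congrFun hc i
    rw [Matrix.sub_mulVec, Matrix.neg_mulVec, Matrix.one_mulVec] at hc'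
    simp only [Matrix.mulVec, dotProduct, Fin.sum_univ_two, Matrix.map_apply, Pi.smul_apply,
      Pi.sub_apply, Pi.neg_apply, Pi.add_apply, smul_eq_mul, hk, Matrix.cons_val_zero,
      Matrix.cons_val_one] at ha' hb' hc'
    apply_fun (fun x : ℝ => (x : ℂ)) at ha' hb' hc'
    push_cast at ha' hb' hc'
    have key : g₀ * g * g₀⁻¹ = g₁ ^ N i 0 * g₂ ^ N i 1 * g₃ ^ k := by
      ext1 ⟨w, z⟩
      simp only [Equiv.Perm.mul_apply, hg₀inv, hg, hg₀, zpow_apply_of_affine hg₁,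
        zpow_apply_of_affine hg₂, zpow_apply_of_affine hg₃]
      refine Prod.ext ?_ ?_
      · linear_combination -ha' + w * mul_inv_cancel₀ hα0
      · linear_combination -w * hb' + hc'
    rw [key]
    exact mul_mem (mul_mem (zpow_mem (hmem _ (by simp)) _) (zpow_mem (hmem _ (by simp)) _))
      (zpow_mem (hmem _ (by simp)) _)
  refine Subgroup.index_closure_insert_sq_eq_two g₀ {g₁, g₂, g₃} ?_ ?_
  · rintro g (rfl | rfl | rfl)
    · exact conj_mem 0 _ p hg₁ rfl
    · exact conj_mem 1 _ q hg₂ rfl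
    · have key : g₀ * g * g₀⁻¹ = g⁻¹ := by
        rw [eq_inv_iff_mul_eq_one]
        ext1 ⟨w, z⟩
        simp only [Equiv.Perm.mul_apply, hg₃, hg₀inv, hg₀, Equiv.Perm.one_apply]
        simp [hα0]
      rw [key]
      exact inv_mem (hmem _ (by simp))
  · -- The generators of the smaller group commute with the vertical translation `(w, z) ↦ (w, z + 1)`.
    intro h
    let t : Equiv.Perm (ℂ × ℂ) := Equiv.addRight (0, 1)
    have hle : Subgroup.closure {g₀ ^ 2, g₁, g₂, g₃} ≤ Subgroup.centralizer {t} := by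
      rw [Subgroup.closure_le]
      intro g hg
      rw [SetLike.mem_coe, Subgroup.mem_centralizer_singleton_iff]
      ext1 ⟨w, z⟩
      rcases hg with rfl | rfl | rfl | rfl <;>
        simp [t, pow_two, hg₀, hg₁, hg₂, hg₃] <;> ring
    have hcomm := Subgroup.mem_centralizer_singleton_iff.1 (hle h)
    have h0 := congrArg Prod.snd (Equiv.congr_fun hcomm (0, 0))
    simp [t, hg₀] at h0
    norm_num [Complex.ext_iff] at h0
end

section
/- Let r be a nonzero integer and c₁, c₂ real numbers. In the group GL(3, ℝ) of invertible 3×3 real matrices, let A(c) denote the upper unitriangular matrix with (1,2)-entry 1, (1,3)-entry c, and (2,3)-entry 0; let B(c) denote the upper unitriangular matrix with (1,2)-entry 0, (2,3)-entry 1, and (1,3)-entry c; and let C denote the upper unitriangular matrix whose only nonzero off-diagonal entry is the (1,3)-entry, equal to 1/r. Then the subgroup of GL(3, ℝ) generated by {A(c₁), B(c₂), C} is isomorphic as a group to the subgroup generated by {A(0), B(0), C}. (This is the isomorphism of the lattices Λ and Λ_r in the Heisenberg group used in the construction of the Inoue surfaces S⁺_{N,p,q,r,t}.) -/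
open Matrix

/-- Subgroups generated by two triples that are simultaneously conjugate are isomorphic. -/
theorem Subgroup.nonempty_closure_triple_mulEquiv_of_conj {G : Type*} [Group G]
    {p x y z x' y' z' : G} (hx : p * x = x' * p) (hy : p * y = y' * p) (hz : p * z = z' * p) :
    Nonempty (Subgroup.closure {x', y', z'} ≃* Subgroup.closure {x, y, z}) := by
  have h : (Subgroup.closure {x, y, z}).map (MulAut.conj p : G →* G)
      = Subgroup.closure {x', y', z'} := by
    rw [MonoidHom.map_closure]
    simp [Set.image_insert_eq, MulAut.conj_apply, hx, hy, hz]
  exact ⟨(((MulAut.conj p).subgroupMap _).trans (MulEquiv.subgroupCongr h)).symm⟩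

/-- The lattice `Λ` generated by `A(c₁), B(c₂), C` in the Heisenberg group is isomorphic
to the lattice `Λ_r` generated by `A(0), B(0), C`. -/
theorem stmt_14 (r : ℤ) (hr : r ≠ 0) (c₁ c₂ : ℝ)
    (A₁ A₀ B₂ B₀ Cr : GL (Fin 3) ℝ)
    (hA₁ : (A₁ : Matrix (Fin 3) (Fin 3) ℝ) = !![1, 1, c₁; 0, 1, 0; 0, 0, 1])
    (hA₀ : (A₀ : Matrix (Fin 3) (Fin 3) ℝ) = !![1, 1, 0; 0, 1, 0; 0, 0, 1])
    (hB₂ : (B₂ : Matrix (Fin 3) (Fin 3) ℝ) = !![1, 0, c₂; 0, 1, 1; 0, 0, 1])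
    (hB₀ : (B₀ : Matrix (Fin 3) (Fin 3) ℝ) = !![1, 0, 0; 0, 1, 1; 0, 0, 1])
    (hCr : (Cr : Matrix (Fin 3) (Fin 3) ℝ) = !![1, 0, (r : ℝ)⁻¹; 0, 1, 0; 0, 0, 1]) :
    Nonempty ((Subgroup.closure {A₁, B₂, Cr} : Subgroup (GL (Fin 3) ℝ)) ≃*
      (Subgroup.closure {A₀, B₀, Cr} : Subgroup (GL (Fin 3) ℝ))) := by
  obtain ⟨P, hP⟩ : ∃ P : GL (Fin 3) ℝ,
      (P : Matrix (Fin 3) (Fin 3) ℝ) = !![1, c₂, 0; 0, 1, -c₁; 0, 0, 1] :=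
    ⟨GeneralLinearGroup.mkOfDetNeZero !![1, c₂, 0; 0, 1, -c₁; 0, 0, 1]
      (by simp [det_fin_three]), rfl⟩
  apply Subgroup.nonempty_closure_triple_mulEquiv_of_conj (p := P) <;>
    apply Units.ext <;>
    simp [Units.val_mul, hP, hA₁, hA₀, hB₂, hB₀, hCr, add_comm]
end
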